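/- Let f : ℝⁿ → ℝ be a Lebesgue-measurable function with ∫_{ℝⁿ} |f(x)| dx < ∞. Then for every ε > 0 there exists a fully-connected ReLU network of width at most n + 4 — that is, there exist L ∈ ℕ, affine maps A₁ : ℝⁿ → ℝ^{d₁}, A₂ : ℝ^{d₁} → ℝ^{d₂}, …, A_L : ℝ^{d_{L-1}} → ℝ with each intermediate dimension dᵢ ≤ n + 4, such that the function F : ℝⁿ → ℝ defined by F = A_L ∘ σ ∘ A_{L-1} ∘ σ ∘ ⋯ ∘ σ ∘ A₁, where σ applies z ↦ max(0, z) coordinatewise — satisfying ∫_{ℝⁿ} |f(x) − F(x)| dx < ε. -/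

import Mathlib

open MeasureTheory

/-- An affine map `x ↦ W x + b` from `ℝᵃ` to `ℝᵇ`, given by a weight matrix and a bias. -/
structure AffineLayer (a b : ℕ) where
  W : Matrix (Fin b) (Fin a) ℝ
  bias : Fin b → ℝ

/-- Application of an affine layer: `x ↦ W x + b`. -/
def AffineLayer.apply {a b : ℕ} (A : AffineLayer a b) (x : Fin a → ℝ) : Fin b → ℝ :=
  fun i => A.W.mulVec x i + A.bias i

/-- The ReLU activation `z ↦ max(0, z)` applied coordinatewise. -/
def reluVec {a : ℕ} (x : Fin a → ℝ) : Fin a → ℝ := fun i => max 0 (x i)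

/-- `IsReLUNet w n F` states that `F : ℝⁿ → ℝ` is computed by a fully-connected ReLU
network of width at most `w`: `F = A_L ∘ σ ∘ A_{L-1} ∘ σ ∘ ⋯ ∘ σ ∘ A₁` is an alternating
composition of affine maps and the coordinatewise ReLU activation `σ`, where every
intermediate dimension is at most `w`. -/
inductive IsReLUNet (w : ℕ) : ∀ n : ℕ, ((Fin n → ℝ) → ℝ) → Prop
  | single {n : ℕ} (A : AffineLayer n 1) :
      IsReLUNet w n (fun x => A.apply x 0)
  | comp {n d : ℕ} (hd : d ≤ w) (A : AffineLayer n d) {F : (Fin d → ℝ) → ℝ}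
      (hF : IsReLUNet w d F) :
      IsReLUNet w n (fun x => F (reluVec (A.apply x)))

/-- The point `x` with every coordinate clamped below at `-N`, translated by `N` so that all
coordinates are nonnegative. -/
def shiftedClamp {n : ℕ} (N : ℝ) (x : Fin n → ℝ) : Fin n → ℝ := fun i => max 0 (x i + N)

/-- The registers `v` (functions of the input, with nonnegative values) can be computed by ReLU
layers of width `n + 4` which also carry the shifted, clamped input along: any network reading the
clamped input and the registers yields a network reading the input itself. -/
def RegistersComputable (n : ℕ) (N : ℝ) (v : (Fin n → ℝ) → Fin 4 → ℝ) : Prop :=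
  (∀ x j, 0 ≤ v x j) ∧
    ∀ G : (Fin (n + 4) → ℝ) → ℝ, IsReLUNet (n + 4) (n + 4) G →
      IsReLUNet (n + 4) n (fun x => G (Fin.append (shiftedClamp N x) (v x)))

namespace RegistersComputable

variable {n : ℕ} {N : ℝ} {v : (Fin n → ℝ) → Fin 4 → ℝ}

theorem zero (n : ℕ) (N : ℝ) : RegistersComputable n N (fun _ _ => 0) := by
  refine ⟨fun _ _ => le_rfl, fun G hG => ?_⟩
  let A : AffineLayer n (n + 4) :=
    { W := Matrix.of (Fin.append (fun i => Pi.single i 1) (fun _ => 0))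
      bias := Fin.append (fun _ => N) (fun _ => 0) }
  convert IsReLUNet.comp le_rfl A hG using 3 with x
  ext i
  refine Fin.addCases (fun i => ?_) (fun j => ?_) i
  · simp [A, reluVec, AffineLayer.apply, shiftedClamp, Matrix.mulVec]
  · simp [A, reluVec, AffineLayer.apply, Matrix.mulVec]

/-- One register may be overwritten by the ReLU of an affine function of the state. -/
theorem update (hv : RegistersComputable n N v) (k : Fin 4) (a : Fin n → ℝ) (b : Fin 4 → ℝ)
    (c : ℝ) :
    RegistersComputable n N (fun x => Function.update (v x) k
      (max 0 (a ⬝ᵥ shiftedClamp N x + b ⬝ᵥ v x + c))) := by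
  refine ⟨fun x j => ?_, fun G hG => ?_⟩
  · by_cases h : j = k
    · subst h; simp
    · simpa [h] using hv.1 x j
  let A : AffineLayer (n + 4) (n + 4) :=
    { W := Matrix.of (Fin.append (fun i => Fin.append (Pi.single i 1) 0)
        (Function.update (fun j => Fin.append 0 (Pi.single j 1)) k (Fin.append a b)))
      bias := Fin.append 0 (Pi.single k c) }
  convert hv.2 _ (IsReLUNet.comp le_rfl A hG) using 3 with x
  have happ : ∀ (p p' : Fin n → ℝ) (q q' : Fin 4 → ℝ),
      Fin.append p q ⬝ᵥ Fin.append p' q' = p ⬝ᵥ p' + q ⬝ᵥ q' := by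
    intro p p' q q'
    simp [dotProduct, Fin.sum_univ_add]
  ext i
  refine Fin.addCases (fun i => ?_) (fun j => ?_) i
  · have : 0 ≤ shiftedClamp N x i := le_max_left _ _
    simp [A, reluVec, AffineLayer.apply, Matrix.mulVec, happ, this]
  · by_cases h : j = k
    · subst h
      simp [A, reluVec, AffineLayer.apply, Matrix.mulVec, happ]
    · simp [A, reluVec, AffineLayer.apply, Matrix.mulVec, happ, h, hv.1 x j]

/-- Register `2` can be decreased, down to zero, by a multiple of the distance between a
coordinate of the clamped input and a given number; register `3` is scratch space. -/
theorem sub_abs (hv : RegistersComputable n N v) (L : ℝ) (i : Fin n) (p : ℝ) :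
    ∃ w, RegistersComputable n N w ∧ (∀ x, w x 0 = v x 0) ∧ (∀ x, w x 1 = v x 1) ∧
      ∀ x, w x 2 = max 0 (v x 2 - L * |shiftedClamp N x i - p|) := by
  have h1 := (hv.update 3 (Pi.single i 1) 0 (-p)).update 2 0 (Pi.single 2 1 + Pi.single 3 (-L)) 0
  have h2 := (h1.update 3 (Pi.single i (-1)) 0 p).update 2 0 (Pi.single 2 1 + Pi.single 3 (-L)) 0
  refine ⟨_, h2, fun x => by simp, fun x => by simp, fun x => ?_⟩
  have h0 := hv.1 x 2
  simp [add_dotProduct]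
  rcases le_total 0 (shiftedClamp N x i - p) with h | h
  · rw [abs_of_nonneg h, max_eq_right (by linarith : 0 ≤ shiftedClamp N x i + -p),
      max_eq_left (by linarith : -shiftedClamp N x i + p ≤ 0)]
    simp [sub_eq_add_neg]
  · rw [abs_of_nonpos h, max_eq_left (by linarith : shiftedClamp N x i + -p ≤ 0),
      max_eq_right (by linarith : 0 ≤ -shiftedClamp N x i + p)]
    simp only [mul_zero, neg_zero, add_zero, max_eq_right h0]
    congr 1; ring

/-- Register `2` can be set to a cone `max 0 (h - L * ∑ |·|)` centred at `p`. -/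
theorem cone (hv : RegistersComputable n N v) {L : ℝ} (hL : 0 ≤ L) (h : ℝ)
    (p : Fin n → ℝ) (s : Finset (Fin n)) :
    ∃ w, RegistersComputable n N w ∧ (∀ x, w x 0 = v x 0) ∧ (∀ x, w x 1 = v x 1) ∧
      ∀ x, w x 2 = max 0 (h - L * ∑ i ∈ s, |shiftedClamp N x i - p i|) := by
  classical
  induction s using Finset.induction_on with
  | empty => exact ⟨_, hv.update 2 0 0 h, by simp, by simp, by simp⟩
  | insert i s hi ih =>
    obtain ⟨w, hw, hw0, hw1, hw2⟩ := ih
    obtain ⟨w', hw', hw0', hw1', hw2'⟩ := hw.sub_abs L i (p i)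
    refine ⟨w', hw', fun x => by rw [hw0', hw0], fun x => by rw [hw1', hw1], fun x => ?_⟩
    rw [hw2', hw2, Finset.sum_insert hi]
    have := mul_nonneg hL (abs_nonneg (shiftedClamp N x i - p i))
    rcases le_total 0 (h - L * ∑ i ∈ s, |shiftedClamp N x i - p i|) with h' | h'
    · rw [max_eq_right h']; congr 1; ring
    · rw [max_eq_left h', max_eq_left, max_eq_left] <;> linarith

/-- Any register `k ≠ 3` can be replaced by its maximum with register `2`. -/
theorem max_two (hv : RegistersComputable n N v) {k : Fin 4} (hk3 : k ≠ 3) :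
    ∃ w, RegistersComputable n N w ∧ (∀ x, w x k = max (v x k) (v x 2)) ∧
      ∀ x j, j ≠ k → j ≠ 3 → w x j = v x j := by
  have h1 := (hv.update 3 0 (Pi.single 2 1 + Pi.single k (-1)) 0).update k 0
    (Pi.single k 1 + Pi.single 3 1) 0
  refine ⟨_, h1, fun x => ?_, fun x j hj hj3 => by simp [hj, hj3]⟩
  have h0 := hv.1 x k
  simp [add_dotProduct, hk3]
  rcases le_total (v x k) (v x 2) with h | h
  · rw [max_eq_right (by linarith : 0 ≤ v x 2 + -v x k), max_eq_right h, max_eq_right] <;> linarith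
  · rw [max_eq_left (by linarith : v x 2 + -v x k ≤ 0), max_eq_left h, max_eq_right] <;> linarith

/-- Register `k ∈ {0, 1}` can be replaced by its maximum with finitely many cones. -/
theorem fold_cones (hv : RegistersComputable n N v) {k : Fin 4} (hk : k = 0 ∨ k = 1) {L : ℝ}
    (hL : 0 ≤ L) (h : (Fin n → ℝ) → ℝ) (P : Finset (Fin n → ℝ)) :
    ∃ w, RegistersComputable n N w ∧
      (∀ x, w x k = P.fold max (v x k)
        fun p => max 0 (h p - L * ∑ i, |shiftedClamp N x i - (p i + N)|)) ∧
      ∀ x j, j = 0 ∨ j = 1 → j ≠ k → w x j = v x j := by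
  classical
  induction P using Finset.induction_on with
  | empty => exact ⟨v, hv, by simp, by simp⟩
  | insert p P hp ih =>
    obtain ⟨w, hw, hwk, hwj⟩ := ih
    obtain ⟨c, hc, hc0, hc1, hc2⟩ := hw.cone hL (h p) (fun i => p i + N) Finset.univ
    have hcj : ∀ x j, j = 0 ∨ j = 1 → c x j = w x j := by
      rintro x j (rfl | rfl)
      exacts [hc0 x, hc1 x]
    obtain ⟨w', hw', hwk', hwj'⟩ := hc.max_two (k := k)
      (by rcases hk with rfl | rfl <;> decide)
    refine ⟨w', hw', fun x => ?_, fun x j hj hjk => ?_⟩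
    · rw [hwk', hcj x k hk, hwk, hc2, Finset.fold_insert hp, max_comm]
    · rw [hwj' x j hjk (by rcases hj with rfl | rfl <;> decide), hcj x j hj, hwj x j hj hjk]

/-- The difference of the first two registers is a network. -/
theorem isReLUNet_sub (hv : RegistersComputable n N v) :
    IsReLUNet (n + 4) n (fun x => v x 0 - v x 1) := by
  let A : AffineLayer (n + 4) 1 :=
    { W := Matrix.of fun _ => Fin.append 0 ![1, -1, 0, 0]
      bias := 0 }
  convert hv.2 _ (IsReLUNet.single A) using 2 with x
  simp [A, AffineLayer.apply, Matrix.mulVec, dotProduct, Fin.sum_univ_add, Fin.sum_univ_four]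
  ring

end RegistersComputable

/-- A nonnegative continuous function supported well inside a ball is approximated, uniformly and
with support in that ball, by a finite maximum of cones evaluated at the clamped input. -/
theorem exists_fold_cones_approx {n : ℕ} {N : ℝ} {g : (Fin n → ℝ) → ℝ} (hg : Continuous g)
    (hgc : HasCompactSupport g) (hg0 : ∀ x, 0 ≤ g x) (hN : ∀ x ∈ tsupport g, ‖x‖ ≤ N - 1)
    {ε : ℝ} (hε : 0 < ε) :
    ∃ L : ℝ, 0 ≤ L ∧ ∃ P : Finset (Fin n → ℝ), ∀ x,
      |g x - P.fold max 0 fun p => max 0 (g p - L * ∑ i, |shiftedClamp N x i - (p i + N)|)| ≤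
        (Metric.closedBall (0 : Fin n → ℝ) N).indicator (fun _ => ε) x := by
  obtain ⟨δ₀, hδ₀, hδ₀g⟩ := Metric.uniformContinuous_iff.1
    (hgc.uniformContinuous_of_continuous hg) (ε / 2) (half_pos hε)
  obtain ⟨M, hM⟩ := hgc.exists_bound_of_continuous hg
  set δ := min δ₀ 1
  have hδ : 0 < δ := lt_min hδ₀ one_pos
  have hδg : ∀ x y, dist x y < δ → |g x - g y| < ε / 2 := fun x y h =>
    hδ₀g (h.trans_le (min_le_left _ _))
  have hM0 : 0 ≤ M := (norm_nonneg _).trans (hM 0)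
  set L := M / δ with hLdef
  have hL : 0 ≤ L := by positivity
  have hLδ : L * δ = M := by rw [hLdef]; field_simp
  set η := min δ (ε / 2 / (L * n + 1)) with hη_def
  have hη : 0 < η := lt_min hδ (by positivity)
  have hηL : L * (n * η) ≤ ε / 2 := by
    have h1 : η * (L * n + 1) ≤ ε / 2 := by
      rw [← le_div_iff₀ (by positivity)]; exact min_le_right _ _
    nlinarith
  obtain ⟨t, htK, htf, htc⟩ := (hgc : IsCompact (tsupport g)).finite_cover_balls hη
  refine ⟨L, hL, htf.toFinset, fun x => ?_⟩
  -- Near a centre, the clamp is inactive.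
  have hnear : ∀ p ∈ t, ∑ i, |shiftedClamp N x i - (p i + N)| < δ → ∀ i, |x i - p i| < δ := by
    intro p hp hd i
    have h1 : |shiftedClamp N x i - (p i + N)| < δ :=
      (Finset.single_le_sum (f := fun i => |shiftedClamp N x i - (p i + N)|)
        (fun _ _ => abs_nonneg _) (Finset.mem_univ i)).trans_lt hd
    have h2 : |p i| ≤ N - 1 := (norm_le_pi_norm p i).trans (hN p (htK hp))
    have h3 : δ ≤ 1 := min_le_right _ _
    rcases le_total 0 (x i + N) with h | h
    · rw [shiftedClamp, max_eq_right h] at h1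
      convert h1 using 2; ring
    · rw [shiftedClamp, max_eq_left h] at h1
      have := (abs_lt.1 h1).1
      have := (abs_le.1 h2).1
      linarith
  have hfar : ∀ p, δ ≤ ∑ i, |shiftedClamp N x i - (p i + N)| →
      g p - L * ∑ i, |shiftedClamp N x i - (p i + N)| ≤ 0 := by
    intro p hd
    have h1 := mul_le_mul_of_nonneg_left hd hL
    have h2 := (le_abs_self _).trans (hM p)
    linarith
  set F := htf.toFinset.fold max 0
    fun p => max 0 (g p - L * ∑ i, |shiftedClamp N x i - (p i + N)|) with hF
  have hF0 : 0 ≤ F := (Finset.le_fold_max _).2 (Or.inl le_rfl)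
  by_cases hx : x ∈ Metric.closedBall (0 : Fin n → ℝ) N
  · rw [Set.indicator_of_mem hx, abs_le]
    constructor
    · have : F ≤ g x + ε / 2 := by
        refine (Finset.fold_max_le _).2 ⟨by linarith [hg0 x], fun p hp => ?_⟩
        have hpt : p ∈ t := by simpa using hp
        refine max_le (by linarith [hg0 x]) ?_
        rcases le_or_gt δ (∑ i, |shiftedClamp N x i - (p i + N)|) with hd | hd
        · linarith [hfar p hd, hg0 x]
        · have h1 : dist x p < δ := (dist_pi_lt_iff hδ).2 fun i => hnear p hpt hd i
          have h2 := (abs_lt.1 (hδg x p h1)).1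
          have h3 : 0 ≤ L * ∑ i, |shiftedClamp N x i - (p i + N)| :=
            mul_nonneg hL (Finset.sum_nonneg fun _ _ => abs_nonneg _)
          linarith
      linarith
    · by_cases hxK : x ∈ tsupport g
      · obtain ⟨p, hp, hxp⟩ := Set.mem_iUnion₂.1 (htc hxK)
        have hxp : dist x p < η := hxp
        have h1 := (abs_lt.1 (hδg x p (hxp.trans_le (min_le_left _ _)))).2
        have h2 : ∑ i, |shiftedClamp N x i - (p i + N)| ≤ n * η := by
          have : ∀ i ∈ Finset.univ, |shiftedClamp N x i - (p i + N)| ≤ η := by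
            intro i _
            have h3 : |x i| ≤ N - 1 := (norm_le_pi_norm x i).trans (hN x hxK)
            rw [shiftedClamp, max_eq_right (by linarith [(abs_le.1 h3).1]), add_sub_add_right_eq_sub]
            exact (dist_le_pi_dist x p i).trans hxp.le
          simpa using Finset.sum_le_sum this
        have h3 := mul_le_mul_of_nonneg_left h2 hL
        have h4 : g p - L * ∑ i, |shiftedClamp N x i - (p i + N)| ≤ F :=
          (Finset.le_fold_max _).2 (Or.inr ⟨p, by simpa using hp, le_max_right _ _⟩)
        linarith
      · linarith [image_eq_zero_of_notMem_tsupport hxK]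
  · have hxK : x ∉ tsupport g := fun h => hx (by
      rw [mem_closedBall_zero_iff]; linarith [hN x h])
    have hFx : F = 0 := by
      refine le_antisymm ((Finset.fold_max_le _).2 ⟨le_rfl, fun p hp => ?_⟩) hF0
      have hpt : p ∈ t := by simpa using hp
      refine max_le le_rfl ?_
      rcases le_or_gt δ (∑ i, |shiftedClamp N x i - (p i + N)|) with hd | hd
      · exact hfar p hd
      · refine absurd ?_ hx
        have h1 : dist x p < δ := (dist_pi_lt_iff hδ).2 fun i => hnear p hpt hd i
        have h2 : δ ≤ 1 := min_le_right _ _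
        have h3 := hN p (htK hpt)
        have h4 := norm_le_norm_add_norm_sub' x p
        rw [dist_eq_norm] at h1
        rw [mem_closedBall_zero_iff]
        linarith
    simp [hx, hFx, image_eq_zero_of_notMem_tsupport hxK]

/-- Compactly supported continuous functions are uniform limits of networks of width `n + 4`
supported in a fixed ball. -/
theorem exists_isReLUNet_abs_sub_le_indicator {n : ℕ} {g : (Fin n → ℝ) → ℝ} (hg : Continuous g)
    (hgc : HasCompactSupport g) :
    ∃ N : ℝ, ∀ ε : ℝ, 0 < ε → ∃ F, IsReLUNet (n + 4) n F ∧ ∀ x,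
      |g x - F x| ≤ (Metric.closedBall (0 : Fin n → ℝ) N).indicator (fun _ => ε) x := by
  obtain ⟨R, hR⟩ := (hgc : IsCompact (tsupport g)).isBounded.exists_norm_le
  refine ⟨R + 1, fun ε hε => ?_⟩
  have key : ∀ φ : ℝ → ℝ, Continuous φ → φ 0 = 0 → (∀ y, 0 ≤ φ y) → ∃ L : ℝ, 0 ≤ L ∧
      ∃ P : Finset (Fin n → ℝ), ∀ x, |φ (g x) - P.fold max 0 fun p =>
        max 0 (φ (g p) - L * ∑ i, |shiftedClamp (R + 1) x i - (p i + (R + 1))|)| ≤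
        (Metric.closedBall (0 : Fin n → ℝ) (R + 1)).indicator (fun _ => ε / 2) x := by
    intro φ hφ hφ0 hφn
    refine exists_fold_cones_approx (g := φ ∘ g) (hφ.comp hg) (hgc.comp_left hφ0)
      (fun x => hφn _) (fun x hx => ?_) (half_pos hε)
    have := hR x (closure_mono (Function.support_comp_subset hφ0 g) hx)
    linarith
  obtain ⟨L₁, hL₁, P₁, h₁⟩ := key (fun y => max 0 y) (by fun_prop) (by simp) (by simp)
  obtain ⟨L₂, hL₂, P₂, h₂⟩ := key (fun y => max 0 (-y)) (by fun_prop) (by simp) (by simp)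
  obtain ⟨v, hv, hv0, hv1⟩ := (RegistersComputable.zero n (R + 1)).fold_cones (k := 0)
    (Or.inl rfl) hL₁ (fun p => max 0 (g p)) P₁
  obtain ⟨w, hw, hw1, hw0⟩ := hv.fold_cones (k := 1)
    (Or.inr rfl) hL₂ (fun p => max 0 (-g p)) P₂
  refine ⟨_, hw.isReLUNet_sub, fun x => ?_⟩
  specialize h₁ x
  specialize h₂ x
  rw [hw0 x 0 (Or.inl rfl) (by decide), hw1, hv0, hv1 x 1 (Or.inr rfl) (by decide)]
  have hgx : g x = max 0 (g x) - max 0 (-g x) := by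
    rcases le_total 0 (g x) with h | h
    · rw [max_eq_right h, max_eq_left (by linarith)]; ring
    · rw [max_eq_left h, max_eq_right (by linarith)]; ring
  have hadd : (Metric.closedBall (0 : Fin n → ℝ) (R + 1)).indicator (fun _ => ε) x =
      (Metric.closedBall (0 : Fin n → ℝ) (R + 1)).indicator (fun _ => ε / 2) x +
      (Metric.closedBall (0 : Fin n → ℝ) (R + 1)).indicator (fun _ => ε / 2) x := by
    by_cases h : x ∈ Metric.closedBall (0 : Fin n → ℝ) (R + 1) <;> simp [h]
  rw [hadd, abs_le]
  rw [abs_le] at h₁ h₂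
  constructor <;> linarith [h₁.1, h₁.2, h₂.1, h₂.2]

/-- **Universal approximation by width-bounded ReLU networks (Lu et al.).**
For every Lebesgue-measurable `f : ℝⁿ → ℝ` with `∫ |f| < ∞` and every `ε > 0`, there is
a fully-connected ReLU network `F` of width at most `n + 4` with `∫ |f - F| < ε`. -/
theorem exists_reluNet_L1_approx {n : ℕ} (f : (Fin n → ℝ) → ℝ)
    (hf : Measurable f)
    (hint : ∫⁻ x, ENNReal.ofReal |f x| ∂(volume : Measure (Fin n → ℝ)) < ⊤) :
    ∀ ε : ℝ, 0 < ε → ∃ F : (Fin n → ℝ) → ℝ, IsReLUNet (n + 4) n F ∧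
      ∫⁻ x, ENNReal.ofReal |f x - F x| ∂(volume : Measure (Fin n → ℝ)) <
        ENNReal.ofReal ε := by
  intro ε hε
  have hfi : Integrable f (volume : Measure (Fin n → ℝ)) := by
    refine ⟨hf.aestronglyMeasurable, ?_⟩
    simpa [HasFiniteIntegral, Real.enorm_eq_ofReal_abs] using hint
  obtain ⟨g, hgc, hfg, hg, -⟩ := hfi.exists_hasCompactSupport_lintegral_sub_le
    (ε := ENNReal.ofReal (ε / 2)) (by simpa using hε)
  obtain ⟨N, hN⟩ := exists_isReLUNet_abs_sub_le_indicator hg hgc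
  set B := Metric.closedBall (0 : Fin n → ℝ) N
  set V := (volume B).toReal with hV
  have hVtop : volume B ≠ ⊤ := (isCompact_closedBall _ _).measure_lt_top.ne
  have hV0 : 0 ≤ V := ENNReal.toReal_nonneg
  have hη : 0 < ε / 4 / (V + 1) := by positivity
  obtain ⟨F, hF, hgF⟩ := hN _ hη
  refine ⟨F, hF, ?_⟩
  have hgF' : ∫⁻ x, B.indicator (fun _ => ENNReal.ofReal (ε / 4 / (V + 1))) x ≤
      ENNReal.ofReal (ε / 4) := by
    rw [lintegral_indicator_const measurableSet_closedBall, ← ENNReal.ofReal_toReal hVtop, ← hV,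
      ← ENNReal.ofReal_mul hη.le]
    refine ENNReal.ofReal_le_ofReal ?_
    rw [div_mul_eq_mul_div, div_le_iff₀ (by positivity)]
    nlinarith
  calc ∫⁻ x, ENNReal.ofReal |f x - F x|
      ≤ ∫⁻ x, (‖f x - g x‖ₑ + B.indicator (fun _ => ENNReal.ofReal (ε / 4 / (V + 1))) x) := by
        refine lintegral_mono fun x => ?_
        have h1 : B.indicator (fun _ => ENNReal.ofReal (ε / 4 / (V + 1))) x =
            ENNReal.ofReal (B.indicator (fun _ => ε / 4 / (V + 1)) x) := by
          by_cases h : x ∈ B <;> simp [h]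
        rw [h1, Real.enorm_eq_ofReal_abs, ← ENNReal.ofReal_add (abs_nonneg _)
          ((abs_nonneg _).trans (hgF x))]
        refine ENNReal.ofReal_le_ofReal ((abs_sub_le _ (g x) _).trans ?_)
        gcongr
        exact hgF x
    _ = (∫⁻ x, ‖f x - g x‖ₑ) + ∫⁻ x, B.indicator (fun _ => ENNReal.ofReal (ε / 4 / (V + 1))) x :=
        lintegral_add_right _ (measurable_const.indicator measurableSet_closedBall)
    _ ≤ ENNReal.ofReal (ε / 2) + ENNReal.ofReal (ε / 4) := add_le_add hfg hgF'
    _ = ENNReal.ofReal (ε / 2 + ε / 4) := (ENNReal.ofReal_add (by positivity) (by positivity)).symm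
    _ < ENNReal.ofReal ε := (ENNReal.ofReal_lt_ofReal_iff hε).2 (by linarith)
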